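/- Let L be the Laplacian matrix of a strongly connected weighted digraph on N nodes, and let ξ be the positive left eigenvector of L associated with eigenvalue 0 normalized so that ∑_i ξ_i = 1. Let w : [0, ∞) → ℝ^{N·N} be a differentiable function satisfying ẇ(t) = −(L ⊗ I_N) w(t) for all t ≥ 0, where w = col(w_1, …, w_N) with each w_i(t) ∈ ℝ^N, and with initial condition w_i^i(0) = 1 and w_i^k(0) = 0 for all k ≠ i (w_i^k denotes the k-th component of w_i). Then w(t) → 𝟙_N ⊗ ξ as t → ∞; in particular, w_i^i(t) → ξ_i for every i. -/

import Mathlib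

open Matrix Filter

def IsAdjacencyMatrix {N : ℕ} (A : Matrix (Fin N) (Fin N) ℝ) : Prop :=
  (∀ i, A i i = 0) ∧ ∀ i j, 0 ≤ A i j

def IsStronglyConnected {N : ℕ} (A : Matrix (Fin N) (Fin N) ℝ) : Prop :=
  ∀ j i : Fin N, j ≠ i → ∃ (m : ℕ) (k : Fin (m + 1) → Fin N),
    k 0 = j ∧ k (Fin.last m) = i ∧
    ∀ t : Fin m, 0 < A (k t.succ) (k t.castSucc)

def laplacian {N : ℕ} (A : Matrix (Fin N) (Fin N) ℝ) : Matrix (Fin N) (Fin N) ℝ :=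
  Matrix.of fun i j => if i = j then ∑ k, A i k else -A i j


def dirQ {N : ℕ} (A : Matrix (Fin N) (Fin N) ℝ) (ξ y : Fin N → ℝ) : ℝ :=
  ∑ i, ∑ j, ξ i * A i j * (y i - y j) ^ 2

lemma edge_le_dirQ {N : ℕ} (A : Matrix (Fin N) (Fin N) ℝ)
    (hA : IsAdjacencyMatrix A) (ξ : Fin N → ℝ) (hpos : ∀ i, 0 < ξ i) (y : Fin N → ℝ)
    (i j : Fin N) : ξ i * A i j * (y i - y j) ^ 2 ≤ dirQ A ξ y := by
  have hnn : ∀ i j, 0 ≤ ξ i * A i j * (y i - y j) ^ 2 := fun i j =>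
    mul_nonneg (mul_nonneg (hpos i).le (hA.2 i j)) (sq_nonneg _)
  unfold dirQ
  refine (Finset.single_le_sum (f := fun j => ξ i * A i j * (y i - y j) ^ 2)
    (fun j _ => hnn i j) (Finset.mem_univ j)).trans ?_
  exact Finset.single_le_sum (f := fun i => ∑ j, ξ i * A i j * (y i - y j) ^ 2)
    (fun i _ => Finset.sum_nonneg fun j _ => hnn i j) (Finset.mem_univ i)

lemma dirQ_nonneg {N : ℕ} (A : Matrix (Fin N) (Fin N) ℝ)
    (hA : IsAdjacencyMatrix A) (ξ : Fin N → ℝ) (hpos : ∀ i, 0 < ξ i) (y : Fin N → ℝ) :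
    0 ≤ dirQ A ξ y :=
  Finset.sum_nonneg fun i _ => Finset.sum_nonneg fun j _ =>
    mul_nonneg (mul_nonneg (hpos i).le (hA.2 i j)) (sq_nonneg _)

lemma path_le {N : ℕ} (A : Matrix (Fin N) (Fin N) ℝ)
    (hA : IsAdjacencyMatrix A) (ξ : Fin N → ℝ) (hpos : ∀ i, 0 < ξ i) :
    ∀ (m : ℕ) (k : Fin (m + 1) → Fin N),
      (∀ t : Fin m, 0 < A (k t.succ) (k t.castSucc)) →
      ∃ C : ℝ, 0 ≤ C ∧ ∀ y : Fin N → ℝ,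
        (y (k (Fin.last m)) - y (k 0)) ^ 2 ≤ C * dirQ A ξ y := by
  intro m
  induction m with
  | zero =>
    intro k _
    refine ⟨0, le_rfl, fun y => ?_⟩
    have : Fin.last 0 = 0 := rfl
    simp [this]
  | succ m ih =>
    intro k hk
    obtain ⟨C, hC, h⟩ := ih (fun t => k t.castSucc) (fun t => by
      have := hk t.castSucc
      simpa using this)
    have he := hk (Fin.last m)
    rw [Fin.succ_last] at he
    set p := ξ (k (Fin.last (m+1))) * A (k (Fin.last (m+1))) (k (Fin.last m).castSucc) with hp
    have hp0 : 0 < p := mul_pos (hpos _) he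
    refine ⟨2 * C + 2 * p⁻¹, by positivity, fun y => ?_⟩
    have h1 := h y
    have h2 := edge_le_dirQ A hA ξ hpos y (k (Fin.last (m+1))) (k (Fin.last m).castSucc)
    rw [← hp] at h2
    have h3 : (y (k (Fin.last (m+1))) - y (k (Fin.last m).castSucc)) ^ 2
        ≤ p⁻¹ * dirQ A ξ y := by
      rw [inv_mul_eq_div, le_div_iff₀ hp0]
      linarith
    simp only [Fin.castSucc_zero] at h1
    nlinarith [sq_nonneg ((y (k (Fin.last (m+1))) - y (k (Fin.last m).castSucc))
      - (y (k (Fin.last m).castSucc) - y (k 0)))]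

lemma poincare_pair {N : ℕ} (A : Matrix (Fin N) (Fin N) ℝ)
    (hA : IsAdjacencyMatrix A) (hSC : IsStronglyConnected A)
    (ξ : Fin N → ℝ) (hpos : ∀ i, 0 < ξ i) :
    ∃ C : ℝ, 0 < C ∧ ∀ (y : Fin N → ℝ) i j, (y i - y j) ^ 2 ≤ C * dirQ A ξ y := by
  have h : ∀ i j : Fin N, ∃ C : ℝ, 0 ≤ C ∧ ∀ y : Fin N → ℝ,
      (y i - y j) ^ 2 ≤ C * dirQ A ξ y := by
    intro i j
    by_cases hij : j = i
    · subst hij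
      exact ⟨0, le_rfl, fun y => by simp⟩
    · obtain ⟨m, k, rfl, rfl, hk⟩ := hSC j i hij
      exact path_le A hA ξ hpos m k hk
  choose C hC h using h
  have hs : 0 ≤ ∑ i, ∑ j, C i j :=
    Finset.sum_nonneg fun i _ => Finset.sum_nonneg fun j _ => hC i j
  refine ⟨1 + ∑ i, ∑ j, C i j, by linarith, fun y i j => (h i j y).trans ?_⟩
  refine mul_le_mul_of_nonneg_right ?_ (dirQ_nonneg A hA ξ hpos y)
  have h1 : C i j ≤ ∑ j, C i j :=
    Finset.single_le_sum (f := fun j => C i j) (fun j _ => hC i j) (Finset.mem_univ j)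
  have h2 : ∑ j, C i j ≤ ∑ i, ∑ j, C i j :=
    Finset.single_le_sum (f := fun i => ∑ j, C i j)
      (fun i _ => Finset.sum_nonneg fun j _ => hC i j) (Finset.mem_univ i)
  linarith

lemma lap_apply {N : ℕ} (A : Matrix (Fin N) (Fin N) ℝ)
    (hA : IsAdjacencyMatrix A) (y : Fin N → ℝ) (i : Fin N) :
    ∑ j, laplacian A i j * y j = ∑ j, A i j * (y i - y j) := by
  have : ∀ j, laplacian A i j * y j
      = (if i = j then (∑ k, A i k) * y j else 0) - A i j * y j := by
    intro j
    unfold laplacian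
    by_cases h : i = j
    · subst h; simp [hA.1]
    · simp [h]
  simp only [this, Finset.sum_sub_distrib, mul_sub, Finset.sum_ite_eq, Finset.mem_univ, if_true,
    Finset.sum_mul]

lemma left_null {N : ℕ} (A : Matrix (Fin N) (Fin N) ℝ)
    (ξ : Fin N → ℝ) (hleft : ξ ᵥ* laplacian A = 0) (y : Fin N → ℝ) :
    ∑ i, ξ i * ∑ j, laplacian A i j * y j = 0 := by
  have h := Matrix.dotProduct_mulVec ξ (laplacian A) y
  rw [hleft, zero_dotProduct] at h
  exact h

lemma diss {N : ℕ} (A : Matrix (Fin N) (Fin N) ℝ)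
    (hA : IsAdjacencyMatrix A)
    (ξ : Fin N → ℝ) (hleft : ξ ᵥ* laplacian A = 0) (x : Fin N → ℝ) (c : ℝ) :
    ∑ i, ξ i * (2 * (x i - c) * -(∑ j, laplacian A i j * x j)) = - dirQ A ξ x := by
  have h := left_null A ξ hleft (fun i => (x i - c) ^ 2)
  simp only [lap_apply A hA] at h ⊢
  have h2 : ∑ i, ξ i * (2 * (x i - c) * -(∑ j, A i j * (x i - x j))) + dirQ A ξ x
      + ∑ i, ξ i * ∑ j, A i j * ((x i - c) ^ 2 - (x j - c) ^ 2) = 0 := by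
    unfold dirQ
    rw [← Finset.sum_add_distrib, ← Finset.sum_add_distrib]
    refine Finset.sum_eq_zero fun i _ => ?_
    rw [← Finset.sum_neg_distrib, Finset.mul_sum, Finset.mul_sum, Finset.mul_sum,
      ← Finset.sum_add_distrib, ← Finset.sum_add_distrib]
    refine Finset.sum_eq_zero fun j _ => ?_
    ring
  linarith

lemma var_le {N : ℕ} (ξ : Fin N → ℝ) (hpos : ∀ i, 0 < ξ i) (hsum : ∑ i, ξ i = 1)
    (x : Fin N → ℝ) (c : ℝ) (hc : ∑ i, ξ i * x i = c) (B : ℝ)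
    (hB : ∀ i j, (x i - x j) ^ 2 ≤ B) : ∑ i, ξ i * (x i - c) ^ 2 ≤ B := by
  have h0 : 0 ≤ ∑ i, ∑ j, ξ i * ξ j * (B - (x i - x j) ^ 2) :=
    Finset.sum_nonneg fun i _ => Finset.sum_nonneg fun j _ =>
      mul_nonneg (mul_nonneg (hpos i).le (hpos j).le) (by linarith [hB i j])
  have h1 : ∀ i, ∑ j, ξ i * ξ j * (B - (x i - x j) ^ 2)
      = ξ i * B - ξ i * (x i - c) ^ 2 - ξ i * ∑ j, ξ j * (x j - c) ^ 2 := by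
    intro i
    have : ∀ j, ξ i * ξ j * (B - (x i - x j) ^ 2)
        = ξ i * (B - (x i - c) ^ 2 - 2 * (x i - c) * c) * ξ j
          + ξ i * (2 * (x i - c)) * (ξ j * x j) - ξ i * (ξ j * (x j - c) ^ 2) := by
      intro j; ring
    simp only [this, Finset.sum_sub_distrib, Finset.sum_add_distrib, ← Finset.mul_sum, hsum, hc]
    ring
  simp only [h1, Finset.sum_sub_distrib, ← Finset.sum_mul, hsum] at h0
  have h2 : 0 ≤ ∑ i, ξ i * (x i - c) ^ 2 :=
    Finset.sum_nonneg fun i _ => mul_nonneg (hpos i).le (sq_nonneg _)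
  linarith

lemma flow_tendsto {N : ℕ} (A : Matrix (Fin N) (Fin N) ℝ)
    (hA : IsAdjacencyMatrix A) (hSC : IsStronglyConnected A)
    (ξ : Fin N → ℝ) (hpos : ∀ i, 0 < ξ i) (hsum : ∑ i, ξ i = 1)
    (hleft : ξ ᵥ* laplacian A = 0)
    (x : ℝ → Fin N → ℝ)
    (hode : ∀ t : ℝ, 0 ≤ t → ∀ i,
      HasDerivAt (fun s => x s i) (-(∑ j, laplacian A i j * x t j)) t)
    (c : ℝ) (hc : ∑ i, ξ i * x 0 i = c) (i : Fin N) :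
    Tendsto (fun t => x t i) atTop (nhds c) := by
  obtain ⟨C, hC, hP⟩ := poincare_pair A hA hSC ξ hpos
  have hcons : ∀ t, 0 ≤ t → ∑ i, ξ i * x t i = c := by
    intro t ht
    have hd : ∀ s, 0 ≤ s → HasDerivAt (fun s => ∑ i, ξ i * x s i) 0 s := by
      intro s hs
      have h := HasDerivAt.fun_sum (u := Finset.univ) fun i _ => (hode s hs i).const_mul (ξ i)
      refine h.congr_deriv ?_
      have := left_null A ξ hleft (x s)
      simp only [mul_neg, Finset.sum_neg_distrib, this, neg_zero]
    rw [← hc]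
    exact constant_of_has_deriv_right_zero (a := 0) (b := t)
      (fun s hs => (hd s hs.1).continuousAt.continuousWithinAt)
      (fun s hs => (hd s hs.1).hasDerivWithinAt) t ⟨ht, le_rfl⟩
  set V : ℝ → ℝ := fun t => ∑ i, ξ i * (x t i - c) ^ 2 with hV
  have hVd : ∀ t, 0 ≤ t → HasDerivAt V (- dirQ A ξ (x t)) t := by
    intro t ht
    rw [← diss A hA ξ hleft (x t) c]
    refine HasDerivAt.fun_sum fun i _ => ?_
    have h := (((hode t ht i).sub_const c).pow 2).const_mul (ξ i)
    refine h.congr_deriv ?_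
    simp
  have hVQ : ∀ t, 0 ≤ t → V t ≤ C * dirQ A ξ (x t) := fun t ht =>
    var_le ξ hpos hsum (x t) c (hcons t ht) _ (hP (x t))
  have hE : ∀ t, HasDerivAt (fun t : ℝ => Real.exp (t / C)) (Real.exp (t / C) * (1 / C)) t :=
    fun t => ((hasDerivAt_id t).div_const C).exp
  have hanti : AntitoneOn (fun t => V t * Real.exp (t / C)) (Set.Ici 0) := by
    have hd : ∀ t, 0 ≤ t → HasDerivAt (fun t => V t * Real.exp (t / C)) _ t := fun t ht =>
      (hVd t ht).mul (hE t)
    refine antitoneOn_of_deriv_nonpos (convex_Ici 0)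
      (fun t ht => (hd t ht).continuousAt.continuousWithinAt)
      (fun t ht => ?_) (fun t ht => ?_)
    · rw [interior_Ici] at ht
      exact (hd t (le_of_lt ht)).differentiableAt.differentiableWithinAt
    · rw [interior_Ici] at ht
      rw [(hd t (le_of_lt ht)).deriv]
      have h1 := hVQ t (le_of_lt ht)
      have h2 : V t * (1 / C) ≤ dirQ A ξ (x t) := by
        rw [mul_one_div, div_le_iff₀ hC]; linarith
      have h3 := Real.exp_pos (t / C)
      nlinarith
  have hbound : ∀ t, 0 ≤ t → V t ≤ V 0 * Real.exp (-(t / C)) := by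
    intro t ht
    have h := hanti (Set.mem_Ici.2 le_rfl) (Set.mem_Ici.2 ht) ht
    simp only [zero_div, Real.exp_zero, mul_one] at h
    rw [Real.exp_neg, ← div_eq_mul_inv, le_div_iff₀ (Real.exp_pos _)]
    exact h
  have hlim : Tendsto (fun t => V 0 * Real.exp (-(t / C)) / ξ i) atTop (nhds 0) := by
    have h1 : Tendsto (fun t : ℝ => Real.exp (-(t / C))) atTop (nhds 0) :=
      Real.tendsto_exp_neg_atTop_nhds_zero.comp (tendsto_id.atTop_div_const hC)
    simpa using (h1.const_mul (V 0)).div_const (ξ i)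
  have hsq : Tendsto (fun t => (x t i - c) ^ 2) atTop (nhds 0) := by
    refine squeeze_zero' (Eventually.of_forall fun t => sq_nonneg _) ?_ hlim
    filter_upwards [eventually_ge_atTop 0] with t ht
    rw [le_div_iff₀ (hpos i)]
    refine le_trans ?_ (hbound t ht)
    rw [mul_comm]
    exact Finset.single_le_sum (f := fun i => ξ i * (x t i - c) ^ 2)
      (fun i _ => mul_nonneg (hpos i).le (sq_nonneg _)) (Finset.mem_univ i)
  have habs : Tendsto (fun t => |x t i - c|) atTop (nhds 0) := by
    have h := hsq.sqrt
    simpa [Real.sqrt_sq_eq_abs] using h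
  have h := (tendsto_zero_iff_abs_tendsto_zero _).2 habs
  simpa using h.add_const c

/-- along the flow `ẇ = -(L ⊗ I_N) w` (written blockwise:
`d/dt w_i^k = -∑_j L_{ij} w_j^k`) with initial condition `w_i^i(0) = 1` and
`w_i^k(0) = 0` for `k ≠ i`, the state converges to `𝟙_N ⊗ ξ` as `t → ∞`,
i.e. every block `w_i(t)` converges to `ξ`; in particular `w_i^i(t) → ξ_i`.
Here `w t i : Fin N → ℝ` is the block `w_i(t) ∈ ℝ^N` of
`w = col(w_1, …, w_N) : ℝ^{N·N}`. -/
theorem laplacian_flow_tendsto_ones_kron_xi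
    {N : ℕ} (hN : 2 ≤ N) (A : Matrix (Fin N) (Fin N) ℝ)
    (hA : IsAdjacencyMatrix A) (hSC : IsStronglyConnected A)
    (ξ : Fin N → ℝ) (hpos : ∀ i, 0 < ξ i) (hsum : ∑ i, ξ i = 1)
    (hleft : ξ ᵥ* laplacian A = 0)
    (w : ℝ → Fin N → Fin N → ℝ)
    (hode : ∀ t : ℝ, 0 ≤ t → ∀ i k : Fin N,
      HasDerivAt (fun s => w s i k) (-(∑ j, laplacian A i j * w t j k)) t)
    (hinit_diag : ∀ i, w 0 i i = 1)
    (hinit_off : ∀ i k, k ≠ i → w 0 i k = 0) :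
    Tendsto w atTop (nhds (fun _ k => ξ k)) ∧
    ∀ i, Tendsto (fun t => w t i i) atTop (nhds (ξ i)) := by
  have key : ∀ i k, Tendsto (fun t => w t i k) atTop (nhds (ξ k)) := by
    intro i k
    refine flow_tendsto A hA hSC ξ hpos hsum hleft (fun t i => w t i k)
      (fun t ht i => hode t ht i k) (ξ k) ?_ i
    rw [Finset.sum_eq_single k]
    · simp [hinit_diag]
    · intro b _ hb
      simp [hinit_off b k (Ne.symm hb)]
    · simp
  exact ⟨tendsto_pi_nhds.2 fun i => tendsto_pi_nhds.2 fun k => key i k, fun i => key i i⟩
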